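/- arXiv:1112.2016 — 2 statements merged into one kernel-verified Lean document; each statement's English description precedes it below -/
import Mathlib

section
/- For every δ ∈ (0,1) there is a constant c_δ > 0 with the following property: for every w ∈ ℂ with 0 ≤ Re w < π/2 and Im w > 0, writing z = sin w, if 0 ≤ Re z < 1 − δ and 0 < Im z < δ/100, then Im(sin w · cos w) + 2·Im w ≥ c_δ · Im z. (Equivalently, the function φ(z) = −i z (1−z)^{1/2}(1+z)^{1/2} − 2i·arcsin z + iπ appearing in the Plancherel–Rotach asymptotics satisfies Re φ(z) ≥ c_δ · Im z in this region, since Re φ(sin w) = Im(sin w · cos w) + 2 Im w.) -/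
noncomputable section
open Complex Real

theorem Real.sinh_le_self_mul_exp (b : ℝ) : Real.sinh b ≤ b * Real.exp b := by
  have h := Real.add_one_le_exp (-b - b)
  have h2 : Real.exp (-b) = Real.exp (-b - b) * Real.exp b := by
    rw [← Real.exp_add]; ring_nf
  rw [Real.sinh_eq, h2]
  nlinarith [Real.exp_pos b]

theorem Complex.re_sin_eq (w : ℂ) :
    (Complex.sin w).re = Real.sin w.re * Real.cosh w.im := by
  rw [Complex.sin_eq]
  simp [Complex.sin_ofReal_re]

theorem Complex.im_sin_eq (w : ℂ) :
    (Complex.sin w).im = Real.cos w.re * Real.sinh w.im := by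
  rw [Complex.sin_eq]
  simp [Complex.cos_ofReal_re, Complex.sinh_ofReal_re]

theorem Complex.re_cos_eq (w : ℂ) :
    (Complex.cos w).re = Real.cos w.re * Real.cosh w.im := by
  rw [Complex.cos_eq]
  simp [Complex.cos_ofReal_re]

theorem Complex.im_cos_eq (w : ℂ) :
    (Complex.cos w).im = -(Real.sin w.re * Real.sinh w.im) := by
  rw [Complex.cos_eq]
  simp [Complex.sin_ofReal_re, Complex.sinh_ofReal_re]

/-- **Lower bound for the exponent in the Plancherel–Rotach asymptotics.** For every
`δ ∈ (0,1)` there is `c_δ > 0` such that for every `w` in the strip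
`0 ≤ Re w < π/2`, `Im w > 0`, writing `z = sin w`, if `0 ≤ Re z < 1 - δ` and
`0 < Im z < δ/100`, then `Im(sin w · cos w) + 2·Im w ≥ c_δ · Im z`.
(Equivalently, `Re φ(z) ≥ c_δ · Im z` where `φ` is the Plancherel–Rotach phase
`φ(z) = -i z (1-z)^{1/2}(1+z)^{1/2} - 2i·arcsin z + iπ`, since
`Re φ(sin w) = Im(sin w · cos w) + 2·Im w`.) -/
theorem plancherel_rotach_phase_lower_bound
    (δ : ℝ) (hδ0 : 0 < δ) (hδ1 : δ < 1) :
    ∃ c : ℝ, 0 < c ∧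
      ∀ w : ℂ, 0 ≤ w.re → w.re < Real.pi / 2 → 0 < w.im →
        (0 : ℝ) ≤ (Complex.sin w).re → (Complex.sin w).re < 1 - δ →
        0 < (Complex.sin w).im → (Complex.sin w).im < δ / 100 →
        c * (Complex.sin w).im ≤ (Complex.sin w * Complex.cos w).im + 2 * w.im := by
  refine ⟨1 / 2, by norm_num, fun w h0 h1 hb _ hre _ him => ?_⟩
  rw [Complex.mul_im, Complex.re_cos_eq, Complex.im_cos_eq]
  rw [Complex.re_sin_eq] at hre ⊢
  rw [Complex.im_sin_eq] at him ⊢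
  have hs : 0 ≤ Real.sin w.re := Real.sin_nonneg_of_nonneg_of_le_pi h0 (by linarith)
  have hC : 0 < Real.cos w.re := Real.cos_pos_of_mem_Ioo ⟨by linarith, h1⟩
  have hS : 0 < Real.sinh w.im := Real.sinh_pos_iff.2 hb
  have hK : 1 ≤ Real.cosh w.im := Real.one_le_cosh _
  have hKS := Real.cosh_sq w.im
  have hexp := Real.sinh_le_self_mul_exp w.im
  rw [← Real.cosh_add_sinh] at hexp
  have hsC := Real.sin_sq_add_cos_sq w.re
  generalize Real.sin w.re = s at *
  generalize Real.cos w.re = C at *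
  generalize Real.sinh w.im = S at *
  generalize Real.cosh w.im = K at *
  generalize w.im = b at *
  have hs1 : s < 1 - δ := by nlinarith
  have hδC : δ < C := by nlinarith
  have hS1 : S < 1 / 100 := by nlinarith
  have hK1 : K ≤ 1 + S := by nlinarith
  have hC1 : C ≤ 1 := by nlinarith
  have hbS : S ≤ 51 / 50 * b := by nlinarith
  have hSK : S * K ≤ 101 / 100 * S := by nlinarith
  have hCS : C * S ≤ S := by nlinarith
  have hneg : -(S * K) ≤ s * K * -(s * S) + C * S * (C * K) := by
    have : 0 ≤ C ^ 2 * (S * K) := by positivity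
    have hSK0 : 0 ≤ S * K := by positivity
    nlinarith
  linarith
end
end

section
/- For every z ∈ ℂ with Im z > 0, the Stieltjes transform of the semicircle density satisfies the closed-form identity s_sc(z) = ∫_{−1}^{1} (2/π)·√(1−x²)/(x−z) dx = 2·(−z + (z−1)^{1/2}(z+1)^{1/2}), where (z−1)^{1/2} and (z+1)^{1/2} are principal branches of the square root (i.e. (w)^{1/2} = exp((1/2)log|w| + i·(1/2)·arg w) with arg ∈ (−π,π)). -/
noncomputable section
open MeasureTheory

def rhoSC (x : ℝ) : ℝ :=
  Set.indicator (Set.Icc (-1) 1) (fun y => (2 / Real.pi) * Real.sqrt (1 - y ^ 2)) x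

def sSC (z : ℂ) : ℂ := ∫ x in (-1:ℝ)..1, (rhoSC x : ℂ) / ((x : ℂ) - z)

/-- The principal square root maps the upper half-plane into the open first quadrant. -/
lemma cpow_half_mem_quadrant {w : ℂ} (hw : 0 < w.im) :
    0 < (w ^ (1/2 : ℂ)).re ∧ 0 < (w ^ (1/2 : ℂ)).im := by
  have hw0 : w ≠ 0 := by rintro rfl; simp at hw
  have hre : (Complex.log w * (1/2 : ℂ)).re = Real.log ‖w‖ / 2 := by
    rw [show (1/2 : ℂ) = ((1/2 : ℝ) : ℂ) by norm_num, Complex.re_mul_ofReal, Complex.log_re]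
    ring
  have him : (Complex.log w * (1/2 : ℂ)).im = Complex.arg w / 2 := by
    rw [show (1/2 : ℂ) = ((1/2 : ℝ) : ℂ) by norm_num, Complex.im_mul_ofReal, Complex.log_im]
    ring
  have hpos : 0 < Complex.arg w :=
    (Complex.arg_nonneg_iff.2 hw.le).lt_of_ne fun h => hw.ne' (Complex.arg_eq_zero_iff.1 h.symm).2
  have hle := Complex.arg_le_pi w
  have hpi := Real.pi_pos
  have hlt : Complex.arg w < Real.pi :=
    hle.lt_of_ne fun h => hw.ne' (Complex.arg_eq_pi_iff.1 h).2
  rw [Complex.cpow_def_of_ne_zero hw0, Complex.exp_re, Complex.exp_im, hre, him]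
  exact ⟨mul_pos (Real.exp_pos _) (Real.cos_pos_of_mem_Ioo ⟨by linarith, by linarith⟩),
    mul_pos (Real.exp_pos _) (Real.sin_pos_of_pos_of_lt_pi (by linarith) (by linarith))⟩

lemma cpow_half_sq (w : ℂ) : (w ^ (1/2 : ℂ)) ^ 2 = w := by
  rw [one_div]
  exact_mod_cast Complex.cpow_nat_inv_pow w (n := 2) two_ne_zero

lemma norm_sub_lt_norm_add {a b : ℂ} (ha : 0 < a.re ∧ 0 < a.im) (hb : 0 < b.re ∧ 0 < b.im) :
    ‖b - a‖ < ‖b + a‖ := by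
  rw [← sq_lt_sq₀ (norm_nonneg _) (norm_nonneg _), Complex.sq_norm, Complex.sq_norm,
    Complex.normSq_apply, Complex.normSq_apply]
  simp only [Complex.sub_re, Complex.sub_im, Complex.add_re, Complex.add_im]
  nlinarith [mul_pos ha.1 hb.1, mul_pos ha.2 hb.2]

lemma hasDerivAt_log_one_sub_mul_exp {q : ℂ} (hq : ‖q‖ < 1) {c : ℂ} (hc : c.re = 0) (θ : ℝ) :
    HasDerivAt (fun t : ℝ => Complex.log (1 - q * Complex.exp (c * t)))
      (-(c * (q * Complex.exp (c * θ))) / (1 - q * Complex.exp (c * θ))) θ := by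
  have hn : ‖-(q * Complex.exp (c * θ))‖ < 1 := by
    rw [norm_neg, norm_mul, Complex.norm_exp]
    simpa [hc] using hq
  have hs : 1 - q * Complex.exp (c * θ) ∈ Complex.slitPlane := by
    simpa [sub_eq_add_neg] using Complex.mem_slitPlane_of_norm_lt_one hn
  have h1 : HasDerivAt (fun t : ℝ => c * (t : ℂ)) c θ := by
    simpa using (Complex.ofRealCLM.hasDerivAt (x := θ)).const_mul c
  convert ((h1.cexp.const_mul q).const_sub 1).clog_real hs using 1
  ring

lemma integral_sin_sq_div_cos_sub {q : ℂ} (hq0 : q ≠ 0) (hq : ‖q‖ < 1) {z : ℂ} (hz : z.im ≠ 0)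
    (hqz : 2 * z * q = q ^ 2 + 1) :
    ∫ θ in (0:ℝ)..Real.pi, (Real.sin θ : ℂ) ^ 2 / ((Real.cos θ : ℂ) - z) = -(Real.pi * q) := by
  have hne (θ : ℝ) : (Real.cos θ : ℂ) - z ≠ 0 := fun h => hz <| by
    rw [← sub_eq_zero.1 h, Complex.ofReal_im]
  have hI : Complex.I.re = 0 := Complex.I_re
  have hI' : (-Complex.I).re = 0 := by simp
  let F : ℝ → ℂ := fun t => -(Real.sin t : ℂ) - q * t
    + (z - q) * Complex.I * (Complex.log (1 - q * Complex.exp (Complex.I * t))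
      - Complex.log (1 - q * Complex.exp (-Complex.I * t)))
  have hF (θ : ℝ) : HasDerivAt F ((Real.sin θ : ℂ) ^ 2 / ((Real.cos θ : ℂ) - z)) θ := by
    have h := (((Real.hasDerivAt_sin θ).ofReal_comp.neg.sub
      ((Complex.ofRealCLM.hasDerivAt (x := θ)).const_mul q)).add
      (((hasDerivAt_log_one_sub_mul_exp hq hI θ).sub
        (hasDerivAt_log_one_sub_mul_exp hq hI' θ)).const_mul ((z - q) * Complex.I)))
    refine h.congr_deriv ?_
    have hn (c : ℂ) (hc : c.re = 0) : 1 - q * Complex.exp (c * θ) ≠ 0 := fun h => by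
      have h2 : ‖q * Complex.exp (c * θ)‖ = 1 := by rw [← sub_eq_zero.1 h, norm_one]
      rw [norm_mul, Complex.norm_exp] at h2
      simp [hc] at h2
      exact hq.ne h2
    have h1 := hn _ hI
    have h2 := hn _ hI'
    have h3 := hne θ
    have hII := Complex.I_sq
    have hcos : Complex.exp (Complex.I * θ) = Real.cos θ + Real.sin θ * Complex.I := by
      rw [mul_comm, Complex.exp_mul_I]; simp
    have hsin : Complex.exp (-Complex.I * θ) = Real.cos θ - Real.sin θ * Complex.I := by
      rw [show -Complex.I * θ = ((-θ : ℝ) : ℂ) * Complex.I by push_cast; ring,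
        Complex.exp_mul_I]
      simp [sub_eq_add_neg]
    have hsc : (Real.sin θ : ℂ) ^ 2 + (Real.cos θ : ℂ) ^ 2 = 1 := by
      exact_mod_cast Real.sin_sq_add_cos_sq θ
    rw [hcos] at h1 ⊢
    rw [hsin] at h2 ⊢
    simp only [Complex.ofRealCLM_apply, Complex.ofReal_one, mul_one]
    generalize (Real.sin θ : ℂ) = s at *
    generalize (Real.cos θ : ℂ) = c at *
    have hprod : (1 - q * (c + s * Complex.I)) * (1 - q * (c - s * Complex.I))
        = -(2 * q * (c - z)) := by
      linear_combination q ^ 2 * hsc - hqz - q ^ 2 * s ^ 2 * hII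
    have hsum : q * (c + s * Complex.I) / (1 - q * (c + s * Complex.I))
        + q * (c - s * Complex.I) / (1 - q * (c - s * Complex.I)) = -(c - q) / (c - z) := by
      rw [div_add_div _ _ h1 h2, hprod,
        div_eq_div_iff (neg_ne_zero.2 (mul_ne_zero (mul_ne_zero two_ne_zero hq0) h3)) h3]
      linear_combination -2 * q ^ 2 * (c - z) * hsc + 2 * q ^ 2 * s ^ 2 * (c - z) * hII
    calc _ = -c - q + (z - q) * (q * (c + s * Complex.I) / (1 - q * (c + s * Complex.I))
        + q * (c - s * Complex.I) / (1 - q * (c - s * Complex.I))) := by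
          linear_combination -(z - q) * (q * (c + s * Complex.I) / (1 - q * (c + s * Complex.I))
            + q * (c - s * Complex.I) / (1 - q * (c - s * Complex.I))) * hII
      _ = s ^ 2 / (c - z) := by
          rw [hsum]
          field_simp
          linear_combination hqz - hsc
  have hcont : Continuous fun θ : ℝ => (Real.sin θ : ℂ) ^ 2 / ((Real.cos θ : ℂ) - z) :=
    Continuous.div (by fun_prop) (by fun_prop) hne
  rw [intervalIntegral.integral_eq_sub_of_hasDerivAt (fun θ _ => hF θ)
    (hcont.intervalIntegrable _ _)]
  have e1 : Complex.exp (Complex.I * Real.pi) = -1 := by rw [mul_comm, Complex.exp_pi_mul_I]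
  have e2 : Complex.exp (-Complex.I * Real.pi) = -1 := by
    rw [neg_mul, Complex.exp_neg, e1]; norm_num
  simp only [F, e1, e2]
  simp
  ring

lemma sSC_eq_integral_sin_sq (z : ℂ) (hz : z.im ≠ 0) :
    sSC z = (2 / Real.pi : ℝ) *
      ∫ θ in (0:ℝ)..Real.pi, (Real.sin θ : ℂ) ^ 2 / ((Real.cos θ : ℂ) - z) := by
  let g : ℝ → ℂ := fun x => ((2 / Real.pi * Real.sqrt (1 - x ^ 2) : ℝ) : ℂ) / ((x : ℂ) - z)
  have hne (x : ℝ) : (x : ℂ) - z ≠ 0 := fun h => hz <| by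
    rw [← sub_eq_zero.1 h, Complex.ofReal_im]
  have hg : Continuous g := Continuous.div (by fun_prop) (by fun_prop) hne
  have h1 : sSC z = ∫ x in (-1:ℝ)..1, g x := by
    refine intervalIntegral.integral_congr fun x hx => ?_
    rw [Set.uIcc_of_le (by norm_num)] at hx
    simp only [rhoSC, Set.indicator_of_mem hx, g]
  have h2 := intervalIntegral.integral_deriv_smul_comp (a := Real.pi) (b := 0)
    (fun x _ => Real.hasDerivAt_cos x) (by fun_prop) hg
  rw [Real.cos_pi, Real.cos_zero] at h2
  rw [h1, ← h2, intervalIntegral.integral_symm, ← intervalIntegral.integral_neg,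
    ← intervalIntegral.integral_const_mul]
  refine intervalIntegral.integral_congr fun θ hθ => ?_
  rw [Set.uIcc_of_le Real.pi_pos.le] at hθ
  have hs : Real.sqrt (1 - Real.cos θ ^ 2) = Real.sin θ := by
    rw [← Real.sin_sq, Real.sqrt_sq (Real.sin_nonneg_of_mem_Icc hθ)]
  simp only [g, Function.comp_apply, hs, Complex.real_smul]
  push_cast
  ring

/-- **Closed form of the Stieltjes transform of the semicircle law.** For `Im z > 0`,
`∫_{-1}^{1} (2/π)√(1-x²)/(x-z) dx = 2·(-z + (z-1)^{1/2}·(z+1)^{1/2})`, where the square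
roots are principal branches (here realized by the complex power `w ^ (1/2 : ℂ)`, whose
argument lies in `(-π, π]`; for `Im z > 0` the points `z ± 1` avoid the branch cut). -/
theorem sSC_closed_form (z : ℂ) (hz : 0 < z.im) :
    sSC z = 2 * (-z + (z - 1) ^ (1/2 : ℂ) * (z + 1) ^ (1/2 : ℂ)) := by
  have ha := cpow_half_mem_quadrant (w := z - 1) (by simpa using hz)
  have hb := cpow_half_mem_quadrant (w := z + 1) (by simpa using hz)
  have ha2 := cpow_half_sq (z - 1)
  have hb2 := cpow_half_sq (z + 1)
  generalize (z - 1) ^ (1/2 : ℂ) = a at *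
  generalize (z + 1) ^ (1/2 : ℂ) = b at *
  have hlt := norm_sub_lt_norm_add ha hb
  have hinv : (z - a * b) * (z + a * b) = 1 := by
    linear_combination -b ^ 2 * ha2 - (z - 1) * hb2
  have hq0 : z - a * b ≠ 0 := left_ne_zero_of_mul_eq_one hinv
  have hnorm : ‖z - a * b‖ < 1 := by
    have h : ‖b - a‖ * ‖b + a‖ = 2 := by
      rw [← norm_mul, show (b - a) * (b + a) = 2 by linear_combination hb2 - ha2]
      simp
    have hq : z - a * b = (b - a) ^ 2 / 2 := by linear_combination -(ha2 + hb2) / 2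
    rw [hq, norm_div, norm_pow, Complex.norm_ofNat]
    nlinarith [norm_nonneg (b - a), norm_nonneg (b + a)]
  rw [sSC_eq_integral_sin_sq z hz.ne',
    integral_sin_sq_div_cos_sub hq0 hnorm hz.ne' (by linear_combination hinv)]
  have hpi : (Real.pi : ℂ) ≠ 0 := by exact_mod_cast Real.pi_ne_zero
  push_cast
  field_simp
  ring
end
end
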